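/- arXiv:2310.19594 — 2 statements merged into one kernel-verified Lean document; each statement's English description precedes it below -/
import Mathlib

section
/- For every natural number n there exist a finite weighted graph G = (V, E, X) with exactly 8n + 4 vertices and maximum degree at most 4, and a cut σ₀ of G, such that: (i) there is a unique improving 1-flip sequence L from σ₀ whose final cut σ₀^L is a local optimum; (ii) L has length at least 3^n; and (iii) at every intermediate cut reached by L, the vertex moved next by L is the unique vertex whose single-vertex move is improving at that cut. -/
open Finset
open scoped Classical

namespace MaxCut

variable {V : Type*} [Fintype V]

/-- The value of a cut `σ` in graph `G` with weights `X`. -/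
noncomputable def cutValue (G : SimpleGraph V) (X : Sym2 V → ℝ) (σ : V → ℝ) : ℝ :=
  (1 / 2) * ∑ e ∈ Finset.univ.filter (fun e => e ∈ G.edgeSet),
    (1 - Sym2.lift ⟨fun u w => σ u * σ w, fun u w => by ring⟩ e) * X e

/-- Flip the vertices of `S` across the cut. -/
noncomputable def flip (σ : V → ℝ) (S : Finset V) : V → ℝ := fun v => if v ∈ S then -σ v else σ v

/-- The change in cut value caused by flipping all vertices of `S`. -/
noncomputable def impr (G : SimpleGraph V) (X : Sym2 V → ℝ) (σ : V → ℝ) (S : Finset V) : ℝ :=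
  cutValue G X (flip σ S) - cutValue G X σ

/-- The cut obtained from `σ` by performing all moves of the flip sequence. -/
noncomputable def applyList (σ : V → ℝ) : List (Finset V) → (V → ℝ)
  | [] => σ
  | S :: L => applyList (flip σ S) L

/-- A flip sequence is improving from `σ` if each step strictly increases the cut value. -/
def Improving (G : SimpleGraph V) (X : Sym2 V → ℝ) : (V → ℝ) → List (Finset V) → Prop
  | _, [] => True
  | σ, S :: L => 0 < impr G X σ S ∧ Improving G X (flip σ S) L

/-- A cut assigns `1` or `-1` to each vertex. -/
def IsCut (σ : V → ℝ) : Prop := ∀ v, σ v = 1 ∨ σ v = -1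

/-- A local optimum: no single-vertex flip is improving. -/
noncomputable def deg (G : SimpleGraph V) (v : V) : ℕ :=
  (Finset.univ.filter (fun u => G.Adj v u)).card

def IsLocalOpt (G : SimpleGraph V) (X : Sym2 V → ℝ) (σ : V → ℝ) : Prop :=
  ∀ v : V, impr G X σ {v} ≤ 0


def nbr : ℕ → ℕ → List ((ℕ × ℕ) × ℤ)
  | 0, 5 => [((1,0),112),((0,6),70)]
  | 0, 6 => [((0,5),70),((0,7),64)]
  | 0, 7 => [((0,6),64),((1,1),16),((1,3),-16),((1,6),16)]
  | b+1, 0 => [((b+1,5),8),((b+1,4),8),((b+1,2),8),((b,5),7)]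
  | b+1, 1 => [((b+1,5),82),((b+1,2),-9),((b+1,3),73),((b,7),1)]
  | b+1, 2 => [((b+1,1),-9),((b+1,0),8)]
  | b+1, 3 => [((b+1,1),73),((b+1,4),9),((b+1,6),64),((b,7),-1)]
  | b+1, 4 => [((b+1,3),9),((b+1,0),8)]
  | b+1, 5 => [((b+2,0),112),((b+1,0),8),((b+1,1),82)]
  | b+1, 6 => [((b+1,3),64),((b+1,7),64),((b,7),1)]
  | b+1, 7 => [((b+1,6),64),((b+2,1),16),((b+2,3),-16),((b+2,6),16)]
  | _, _ => []

def fld (c : ℕ → ℕ → ℤ) (b r : ℕ) : ℤ := ((nbr b r).map fun p => p.2 * c p.1.1 p.1.2).sum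

def unst (c : ℕ → ℕ → ℤ) (b r : ℕ) : Prop := c b r * fld c b r < 0

def flipc (c : ℕ → ℕ → ℤ) (v : ℕ × ℕ) : ℕ → ℕ → ℤ :=
  fun b r => if b = v.1 ∧ r = v.2 then - c b r else c b r

def Run : (ℕ → ℕ → ℤ) → List (ℕ × ℕ) → (ℕ → ℕ → ℤ) → Prop
  | c, [], c' => c = c'
  | c, v :: L, c' => (v.2 < 8 ∧ ∀ b r, r < 8 → (unst c b r ↔ (b = v.1 ∧ r = v.2))) ∧ Run (flipc c v) L c'

theorem Run.append {L M : List (ℕ × ℕ)} : ∀ {c c' c''}, Run c L c' → Run c' M c'' → Run c (L ++ M) c'' := by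
  induction L with
  | nil => intro c c' c'' h h'; cases h; exact h'
  | cons v L ih => intro c c' c'' h h'; exact ⟨h.1, ih h.2 h'⟩

def rowv (a0 a1 a2 a3 a4 a5 a6 a7 : ℤ) : ℕ → ℤ
  | 0 => a0 | 1 => a1 | 2 => a2 | 3 => a3 | 4 => a4 | 5 => a5 | 6 => a6 | 7 => a7 | _ => 0

def rest (s : ℤ) : ℕ → ℕ → ℤ
  | 0 => rowv 0 0 0 0 0 s s s
  | _+1 => rowv s s (-s) s s s s s

def restS (s : ℤ) : ℕ → ℕ → ℤ
  | 0 => rowv 0 0 0 0 0 (-s) s s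
  | _+1 => rowv s s (-s) s s (-s) s s

def comb (k : ℕ) (up : ℕ → ℕ → ℤ) (x : ℕ → ℤ) (s : ℤ) : ℕ → ℕ → ℤ :=
  fun b => if k < b then up b else if b = k then x else rest s b

def setrow (k : ℕ) (up : ℕ → ℕ → ℤ) (x : ℕ → ℤ) : ℕ → ℕ → ℤ := fun b => if b = k then x else up b

def Bd (c : ℕ → ℕ → ℤ) : Prop := ∀ b r, -1 ≤ c b r ∧ c b r ≤ 1

theorem comb_succ (k up x s) : comb (k+1) up x s = comb k (setrow (k+1) up x) (rest s k) s := by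
  funext b
  unfold comb setrow
  split_ifs <;> first | rfl | omega | (subst_vars; rfl)

theorem rowv_bd {a0 a1 a2 a3 a4 a5 a6 a7 : ℤ} (h0 : -1 ≤ a0 ∧ a0 ≤ 1) (h1 : -1 ≤ a1 ∧ a1 ≤ 1)
    (h2 : -1 ≤ a2 ∧ a2 ≤ 1) (h3 : -1 ≤ a3 ∧ a3 ≤ 1) (h4 : -1 ≤ a4 ∧ a4 ≤ 1) (h5 : -1 ≤ a5 ∧ a5 ≤ 1)
    (h6 : -1 ≤ a6 ∧ a6 ≤ 1) (h7 : -1 ≤ a7 ∧ a7 ≤ 1) (r : ℕ) :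
    -1 ≤ rowv a0 a1 a2 a3 a4 a5 a6 a7 r ∧ rowv a0 a1 a2 a3 a4 a5 a6 a7 r ≤ 1 := by
  rcases r with _ | _ | _ | _ | _ | _ | _ | _ | r <;> simp only [rowv] <;> first | assumption | norm_num

theorem rest_bd {s : ℤ} (hs : s = 1 ∨ s = -1) (b r : ℕ) : -1 ≤ rest s b r ∧ rest s b r ≤ 1 := by
  rcases b with _ | b <;> simp only [rest] <;> apply rowv_bd <;> omega

theorem low_stable (c : ℕ → ℕ → ℤ) (hb : Bd c) (k : ℕ) (s : ℤ) (hs : s = 1 ∨ s = -1)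
    (hr : ∀ b ≤ k, c b = rest s b) (hM : c (k+1) 0 = s) (b r : ℕ) (hbk : b ≤ k) (hr8 : r < 8) :
    ¬ unst c b r := by
  have h0 : c (b+1) 0 = s := by
    rcases Nat.lt_or_ge b k with h | h
    · rw [hr (b+1) h]; rfl
    · have : b = k := by omega
      rw [this]; exact hM
  have h1 := hb (b+1) 1
  have h3 := hb (b+1) 3
  have h6 := hb (b+1) 6
  have e := hr b hbk
  unfold unst fld
  cases b with
  | zero =>
    simp only [zero_add] at *
    interval_cases r <;> simp [nbr, e, rest, rowv, h0] <;> rcases hs with rfl | rfl <;> omega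
  | succ b =>
    have e' := hr b (by omega)
    have e5 : c b 5 = s := by rw [e']; cases b <;> rfl
    have e7 : c b 7 = s := by rw [e']; cases b <;> rfl
    simp only [Nat.add_assoc, Nat.reduceAdd] at h0 h1 h3 h6
    interval_cases r <;> simp [nbr, e, rest, rowv, h0, e5, e7] <;> rcases hs with rfl | rfl <;> omega

theorem comb_Bd {k up x s} (hu : Bd up) (hx : ∀ r, -1 ≤ x r ∧ x r ≤ 1) (hs : s = 1 ∨ s = -1) :
    Bd (comb k up x s) := by
  intro b r
  unfold comb
  split_ifs
  · exact hu b r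
  · exact hx r
  · exact rest_bd hs b r

def US (k : ℕ) (up : ℕ → ℕ → ℤ) (s t : ℤ) : Prop :=
  ∀ x s', x 5 = t → x 7 = s → ∀ b r, k < b → r < 8 → ¬ unst (comb k up x s') b r

theorem fld_congr {c c' : ℕ → ℕ → ℤ} {b r : ℕ} (h1 : c b = c' b) (h2 : c (b+1) = c' (b+1))
    (h3 : ∀ a, b = a+1 → c a 5 = c' a 5 ∧ c a 7 = c' a 7) (hr : r < 8) : (unst c b r ↔ unst c' b r) := by
  unfold unst fld
  cases b with
  | zero => simp only [zero_add] at h2; interval_cases r <;> simp [nbr, h1, h2]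
  | succ b =>
    have := h3 b rfl
    interval_cases r <;> simp [nbr, h1, h2, this.1, this.2]

/-- single step inside block `k+1` -/
theorem step1 (k r0 : ℕ) (hr0 : r0 < 8) (up x s t u) (hs : s = 1 ∨ s = -1) (hu : Bd up)
    (hx : ∀ r, -1 ≤ x r ∧ x r ≤ 1) (hU : US (k+1) up t u) (h5 : x 5 = u) (h7 : x 7 = t)
    (h0 : x 0 = s)
    (hm : ∀ r < 8, (unst (comb (k+1) up x s) (k+1) r ↔ r = r0))
    (x' : ℕ → ℤ) (hx' : x' = fun r => if r = r0 then - x r else x r) :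
    Run (comb (k+1) up x s) [(k+1, r0)] (comb (k+1) up x' s) := by
  refine ⟨⟨hr0, ?_⟩, ?_⟩
  · intro b r hr
    rcases lt_trichotomy b (k+1) with h | h | h
    · have := low_stable (comb (k+1) up x s) (comb_Bd hu hx hs) k s hs
        (by intro b hb; unfold comb; rw [if_neg (by omega), if_neg (by omega)])
        (by unfold comb; rw [if_neg (by omega), if_pos rfl]; exact h0) b r (by omega) hr
      simp only [this, false_iff]
      intro h'; have := h'.1; omega
    · subst h
      simpa using hm r hr
    · have := hU x s h5 h7 b r h hr
      simp only [this, false_iff]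
      intro h'; have := h'.1; omega
  · funext b r
    subst hx'
    simp only [flipc, comb]
    by_cases h : b = k+1
    · subst h; simp
    · simp [h]

def Claim (k : ℕ) : Prop := ∀ up s, (s = 1 ∨ s = -1) → Bd up → up (k+1) 0 = -s → US k up s (-s) →
  ∃ L, Run (comb k up (restS s k) s) L (comb k up (rest (-s) k) (-s)) ∧ 3 ^ k ≤ L.length

theorem startS (k : ℕ) (up s) (hs : s = 1 ∨ s = -1) (hu : Bd up) (hM : up (k+1) 0 = -s)
    (hU : US k up s s) : Run (comb k up (rest s k) s) [(k, 5)] (comb k up (restS s k) s) := by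
  refine ⟨⟨by norm_num, ?_⟩, ?_⟩
  · have hBd : Bd (comb k up (rest s k) s) := comb_Bd hu (rest_bd hs k) hs
    intro b r hr
    simp only
    rcases lt_trichotomy b k with h | h | h
    · obtain ⟨k', rfl⟩ : ∃ k', k = k' + 1 := ⟨k - 1, by omega⟩
      have := low_stable _ hBd k' s hs
        (by intro b hb; unfold comb; rw [if_neg (by omega), if_neg (by omega)])
        (by unfold comb; rw [if_neg (by omega), if_pos rfl]; rfl) b r (by omega) hr
      simp only [this, false_iff]
      omega
    · subst h
      have h1 := hu (b+1) 1
      have h3 := hu (b+1) 3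
      have h6 := hu (b+1) 6
      have e : comb b up (rest s b) s b = rest s b := by unfold comb; simp
      have e1 : comb b up (rest s b) s (b+1) = up (b+1) := by unfold comb; simp
      unfold unst fld
      clear hU
      rcases b with _ | b
      · simp only [zero_add] at *
        generalize comb 0 up (rest s 0) s = c at *
        interval_cases r <;> simp [nbr, e, e1, rest, rowv, hM] <;> rcases hs with rfl | rfl <;> omega
      · have e5 : comb (b+1) up (rest s (b+1)) s b 5 = s := by unfold comb; simp; cases b <;> rfl
        have e7 : comb (b+1) up (rest s (b+1)) s b 7 = s := by unfold comb; simp; cases b <;> rfl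
        generalize comb (b+1) up (rest s (b+1)) s = c at *
        simp only [Nat.add_assoc, Nat.reduceAdd] at e1 h1 h3 h6 hM
        interval_cases r <;> simp [nbr, e, e1, e5, e7, rest, rowv, hM] <;> rcases hs with rfl | rfl <;> omega
    · have := hU (rest s k) s (by cases k <;> rfl) (by cases k <;> rfl) b r h hr
      simp only [this, false_iff]
      omega
  · funext b r
    simp only [flipc, comb]
    by_cases h : b = k
    · subst h; simp
      rcases b with _ | b <;> rcases r with _ | _ | _ | _ | _ | _ | _ | _ | r <;>
        simp [rest, restS, rowv]
    · simp [h]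

/-- a run of the sub-counter -/
theorem subrun (k : ℕ) (hC : Claim k) (up x t s u) (ht : t = 1 ∨ t = -1) (hu : Bd up)
    (hx : ∀ r, -1 ≤ x r ∧ x r ≤ 1) (hU : US (k+1) up s u) (h5 : x 5 = u) (h7 : x 7 = s)
    (h0 : x 0 = -t)
    (hm : ∀ c : ℕ → ℕ → ℤ, c (k+1) = x → c (k+2) = up (k+2) → c k 7 = t → (c k 5 = t ∨ c k 5 = -t) →
      ∀ r < 8, ¬ unst c (k+1) r) :
    ∃ L, Run (comb (k+1) up x t) L (comb (k+1) up x (-t)) ∧ 3 ^ k ≤ L.length := by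
  have hBd : Bd (setrow (k+1) up x) := by
    intro b r; unfold setrow; split_ifs
    · exact hx r
    · exact hu b r
  have key : ∀ v, (v = t ∨ v = -t) → US k (setrow (k+1) up x) t v := by
    intro v hv y s' hy5 hy7 b r hb hr
    rcases Nat.lt_or_ge (k+1) b with h | h
    · have := hU x s' h5 h7 b r h hr
      rwa [fld_congr (c' := comb (k+1) up x s') _ _ _ hr]
      · have h1 : b ≠ k+1 := by omega
        simp [comb, setrow, hb, h, h1]
      · have h1 : b ≠ k := by omega
        have h2 : k < b + 1 := by omega
        have h3 : k + 1 < b + 1 := by omega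
        simp [comb, setrow, h1, h2, h3]
      · intro a ha
        have : comb k (setrow (k+1) up x) y s' a = comb (k+1) up x s' a := by
          unfold comb setrow
          rw [if_pos (by omega)]
          split_ifs <;> first | rfl | omega
        simp [this]
    · obtain rfl : b = k+1 := by omega
      apply hm _ _ _ _ _ r hr
      · simp [comb, setrow]
      · simp [comb, setrow]
      · simp [comb, hy7]
      · simp [comb, hy5, hv]
  obtain ⟨L, hL, hl⟩ := hC (setrow (k+1) up x) t ht hBd (by simp [setrow, h0]) (key _ (Or.inr rfl))
  refine ⟨[(k,5)] ++ L, ?_, by simp; omega⟩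
  rw [comb_succ, comb_succ]
  exact Run.append (startS k _ t ht hBd (by simp [setrow, h0]) (key _ (Or.inl rfl))) hL

theorem step0 (r0 : ℕ) (hr0 : r0 < 8) (up x s t u) (hU : US 0 up t u) (h5 : x 5 = u) (h7 : x 7 = t)
    (hm : ∀ r < 8, (unst (comb 0 up x s) 0 r ↔ r = r0)) (s' : ℤ)
    (x' : ℕ → ℤ) (hx' : x' = fun r => if r = r0 then - x r else x r) :
    Run (comb 0 up x s) [(0, r0)] (comb 0 up x' s') := by
  refine ⟨⟨hr0, ?_⟩, ?_⟩
  · intro b r hr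
    rcases Nat.eq_zero_or_pos b with h | h
    · subst h
      simpa using hm r hr
    · have := hU x s h5 h7 b r h hr
      simp only [this, false_iff]
      intro h'; have := h'.1; omega
  · funext b r
    subst hx'
    simp only [flipc, comb]
    by_cases h : b = 0
    · subst h; simp
    · simp [h, Nat.pos_of_ne_zero h]

theorem claim_zero : Claim 0 := by
  intro up s hs hu hM hU
  simp only [zero_add] at hM
  have h1 := hu 1 1
  have h3 := hu 1 3
  have h6 := hu 1 6
  have A := step0 6 (by norm_num) up (rowv 0 0 0 0 0 (-s) s s) s s (-s) hU rfl rfl (by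
    intro r hr
    unfold unst fld
    interval_cases r <;> simp [nbr, comb, rowv, hM] <;> rcases hs with rfl | rfl <;> omega) s
    (rowv 0 0 0 0 0 (-s) (-s) s) (by
      funext r; rcases r with _ | _ | _ | _ | _ | _ | _ | _ | r <;> simp [rowv])
  have B := step0 7 (by norm_num) up (rowv 0 0 0 0 0 (-s) (-s) s) s s (-s) hU rfl rfl (by
    intro r hr
    unfold unst fld
    interval_cases r <;> simp [nbr, comb, rowv, hM] <;> rcases hs with rfl | rfl <;> omega) (-s)
    (rowv 0 0 0 0 0 (-s) (-s) (-s)) (by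
      funext r; rcases r with _ | _ | _ | _ | _ | _ | _ | _ | r <;> simp [rowv])
  exact ⟨_, A.append B, by simp⟩

theorem pm_bd {s a : ℤ} (hs : s = 1 ∨ s = -1) (h : a = s ∨ a = -s) : -1 ≤ a ∧ a ≤ 1 := by omega

theorem pm_one {s a : ℤ} (hs : s = 1 ∨ s = -1) (h : a = s ∨ a = -s) : a = 1 ∨ a = -1 := by omega

theorem mid_step (k r0 : ℕ) (hr0 : r0 < 8) (up s t) (hs : s = 1 ∨ s = -1) (ht : t = s ∨ t = -s)
    (hu : Bd up) (hM : up (k+2) 0 = -s) (hU : US (k+1) up s (-s))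
    (a1 a2 a3 a4 a6 : ℤ)
    (h1 : a1 = s ∨ a1 = -s) (h2 : a2 = s ∨ a2 = -s) (h3 : a3 = s ∨ a3 = -s)
    (h4 : a4 = s ∨ a4 = -s) (h6 : a6 = s ∨ a6 = -s)
    (hm : ∀ c : ℕ → ℕ → ℤ, Bd c → c (k+1) = rowv t a1 a2 a3 a4 (-s) a6 s → c (k+2) 0 = -s → c k 5 = t →
      c k 7 = t → ∀ r < 8, (unst c (k+1) r ↔ r = r0))
    (x' : ℕ → ℤ)
    (hx' : x' = fun r => if r = r0 then - rowv t a1 a2 a3 a4 (-s) a6 s r else rowv t a1 a2 a3 a4 (-s) a6 s r) :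
    Run (comb (k+1) up (rowv t a1 a2 a3 a4 (-s) a6 s) t) [(k+1, r0)] (comb (k+1) up x' t) := by
  have ht' : t = 1 ∨ t = -1 := pm_one hs ht
  have htn : -t = s ∨ -t = -s := by rcases ht with rfl | rfl <;> simp
  have hx := rowv_bd (a0 := t) (a1 := a1) (a2 := a2) (a3 := a3) (a4 := a4) (a5 := -s) (a6 := a6) (a7 := s)
    (pm_bd hs ht) (pm_bd hs h1) (pm_bd hs h2) (pm_bd hs h3) (pm_bd hs h4) (pm_bd hs (Or.inr rfl))
    (pm_bd hs h6) (pm_bd hs (Or.inl rfl))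
  refine step1 k r0 hr0 up _ t s (-s) ht' hu hx hU rfl rfl rfl ?_ x' hx'
  apply hm _ (comb_Bd hu hx ht')
  · simp [comb]
  · simp [comb, hM]
  · simp [comb]; cases k <;> rfl
  · simp [comb]; cases k <;> rfl

theorem mid_run (k : ℕ) (hC : Claim k) (up s t) (hs : s = 1 ∨ s = -1) (ht : t = s ∨ t = -s)
    (hu : Bd up) (hM : up (k+2) 0 = -s) (hU : US (k+1) up s (-s))
    (a1 a2 a3 a4 a6 : ℤ)
    (h1 : a1 = s ∨ a1 = -s) (h2 : a2 = s ∨ a2 = -s) (h3 : a3 = s ∨ a3 = -s)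
    (h4 : a4 = s ∨ a4 = -s) (h6 : a6 = s ∨ a6 = -s)
    (hm : ∀ c : ℕ → ℕ → ℤ, c (k+1) = rowv (-t) a1 a2 a3 a4 (-s) a6 s → c (k+2) 0 = -s →
      (-1 ≤ c (k+2) 1 ∧ c (k+2) 1 ≤ 1) → (-1 ≤ c (k+2) 3 ∧ c (k+2) 3 ≤ 1) →
      (-1 ≤ c (k+2) 6 ∧ c (k+2) 6 ≤ 1) → (c k 5 = t ∨ c k 5 = -t) →
      c k 7 = t → ∀ r < 8, ¬ unst c (k+1) r) :
    ∃ L, Run (comb (k+1) up (rowv (-t) a1 a2 a3 a4 (-s) a6 s) t) L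
      (comb (k+1) up (rowv (-t) a1 a2 a3 a4 (-s) a6 s) (-t)) ∧ 3 ^ k ≤ L.length := by
  have ht' : t = 1 ∨ t = -1 := pm_one hs ht
  have htn : -t = s ∨ -t = -s := by rcases ht with rfl | rfl <;> simp
  have hx := rowv_bd (a0 := -t) (a1 := a1) (a2 := a2) (a3 := a3) (a4 := a4) (a5 := -s) (a6 := a6) (a7 := s)
    (pm_bd hs htn) (pm_bd hs h1) (pm_bd hs h2) (pm_bd hs h3) (pm_bd hs h4) (pm_bd hs (Or.inr rfl))
    (pm_bd hs h6) (pm_bd hs (Or.inl rfl))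
  refine subrun k hC up _ t s (-s) ht' hu hx hU rfl rfl rfl ?_
  intro c e1 e2 e3 e4 r hr
  exact hm c e1 (by rw [e2, hM]) (by rw [e2]; exact hu _ _) (by rw [e2]; exact hu _ _)
    (by rw [e2]; exact hu _ _) e4 e3 r hr

theorem claim_succ (k : ℕ) (hC : Claim k) : Claim (k+1) := by
  intro up s hs hu hM hU
  have S1 := mid_step k 0 (by norm_num) up s s hs (by simp) hu hM hU s (-s) s s s
    (by simp) (by simp) (by simp) (by simp) (by simp)
    (by
      intro c hb e e0 e5 e7 r hr
      have h1 := hb (k+2) 1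
      have h3 := hb (k+2) 3
      have h6 := hb (k+2) 6
      unfold unst fld
      interval_cases r <;> simp [nbr, e, e0, e5, e7, rowv] <;> rcases hs with rfl | rfl <;> omega)
    (rowv (-s) s (-s) s s (-s) s s)
    (by funext r; rcases r with _ | _ | _ | _ | _ | _ | _ | _ | r <;> simp [rowv])
  obtain ⟨L1, R1, l1⟩ := mid_run k hC up s s hs (by simp) hu hM hU s (-s) s s s
    (by simp) (by simp) (by simp) (by simp) (by simp)
    (by
      intro c e e0 h1 h3 h6 e5 e7 r hr
      unfold unst fld
      interval_cases r <;> simp [nbr, e, e0, e7, rowv] <;> rcases hs with rfl | rfl <;> omega)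
  have S2 := mid_step k 1 (by norm_num) up s (-s) hs (by simp) hu hM hU s (-s) s s s
    (by simp) (by simp) (by simp) (by simp) (by simp)
    (by
      intro c hb e e0 e5 e7 r hr
      have h1 := hb (k+2) 1
      have h3 := hb (k+2) 3
      have h6 := hb (k+2) 6
      unfold unst fld
      interval_cases r <;> simp [nbr, e, e0, e5, e7, rowv] <;> rcases hs with rfl | rfl <;> omega)
    (rowv (-s) (-s) (-s) s s (-s) s s)
    (by funext r; rcases r with _ | _ | _ | _ | _ | _ | _ | _ | r <;> simp [rowv])
  have S3 := mid_step k 2 (by norm_num) up s (-s) hs (by simp) hu hM hU (-s) (-s) s s s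
    (by simp) (by simp) (by simp) (by simp) (by simp)
    (by
      intro c hb e e0 e5 e7 r hr
      have h1 := hb (k+2) 1
      have h3 := hb (k+2) 3
      have h6 := hb (k+2) 6
      unfold unst fld
      interval_cases r <;> simp [nbr, e, e0, e5, e7, rowv] <;> rcases hs with rfl | rfl <;> omega)
    (rowv (-s) (-s) s s s (-s) s s)
    (by funext r; rcases r with _ | _ | _ | _ | _ | _ | _ | _ | r <;> simp [rowv])
  have S4 := mid_step k 0 (by norm_num) up s (-s) hs (by simp) hu hM hU (-s) s s s s
    (by simp) (by simp) (by simp) (by simp) (by simp)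
    (by
      intro c hb e e0 e5 e7 r hr
      have h1 := hb (k+2) 1
      have h3 := hb (k+2) 3
      have h6 := hb (k+2) 6
      unfold unst fld
      interval_cases r <;> simp [nbr, e, e0, e5, e7, rowv] <;> rcases hs with rfl | rfl <;> omega)
    (rowv (- -s) (-s) s s s (-s) s s)
    (by funext r; rcases r with _ | _ | _ | _ | _ | _ | _ | _ | r <;> simp [rowv])
  obtain ⟨L2, R2, l2⟩ := mid_run k hC up s (-s) hs (by simp) hu hM hU (-s) s s s s
    (by simp) (by simp) (by simp) (by simp) (by simp)
    (by
      intro c e e0 h1 h3 h6 e5 e7 r hr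
      unfold unst fld
      interval_cases r <;> simp [nbr, e, e0, e7, rowv] <;> rcases hs with rfl | rfl <;> omega)
  rw [neg_neg] at R2 S4
  have S5 := mid_step k 3 (by norm_num) up s s hs (by simp) hu hM hU (-s) s s s s
    (by simp) (by simp) (by simp) (by simp) (by simp)
    (by
      intro c hb e e0 e5 e7 r hr
      have h1 := hb (k+2) 1
      have h3 := hb (k+2) 3
      have h6 := hb (k+2) 6
      unfold unst fld
      interval_cases r <;> simp [nbr, e, e0, e5, e7, rowv] <;> rcases hs with rfl | rfl <;> omega)
    (rowv s (-s) s (-s) s (-s) s s)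
    (by funext r; rcases r with _ | _ | _ | _ | _ | _ | _ | _ | r <;> simp [rowv])
  have S6 := mid_step k 4 (by norm_num) up s s hs (by simp) hu hM hU (-s) s (-s) s s
    (by simp) (by simp) (by simp) (by simp) (by simp)
    (by
      intro c hb e e0 e5 e7 r hr
      have h1 := hb (k+2) 1
      have h3 := hb (k+2) 3
      have h6 := hb (k+2) 6
      unfold unst fld
      interval_cases r <;> simp [nbr, e, e0, e5, e7, rowv] <;> rcases hs with rfl | rfl <;> omega)
    (rowv s (-s) s (-s) (-s) (-s) s s)
    (by funext r; rcases r with _ | _ | _ | _ | _ | _ | _ | _ | r <;> simp [rowv])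
  have S7 := mid_step k 0 (by norm_num) up s s hs (by simp) hu hM hU (-s) s (-s) (-s) s
    (by simp) (by simp) (by simp) (by simp) (by simp)
    (by
      intro c hb e e0 e5 e7 r hr
      have h1 := hb (k+2) 1
      have h3 := hb (k+2) 3
      have h6 := hb (k+2) 6
      unfold unst fld
      interval_cases r <;> simp [nbr, e, e0, e5, e7, rowv] <;> rcases hs with rfl | rfl <;> omega)
    (rowv (-s) (-s) s (-s) (-s) (-s) s s)
    (by funext r; rcases r with _ | _ | _ | _ | _ | _ | _ | _ | r <;> simp [rowv])
  obtain ⟨L3, R3, l3⟩ := mid_run k hC up s s hs (by simp) hu hM hU (-s) s (-s) (-s) s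
    (by simp) (by simp) (by simp) (by simp) (by simp)
    (by
      intro c e e0 h1 h3 h6 e5 e7 r hr
      unfold unst fld
      interval_cases r <;> simp [nbr, e, e0, e7, rowv] <;> rcases hs with rfl | rfl <;> omega)
  have S8 := mid_step k 6 (by norm_num) up s (-s) hs (by simp) hu hM hU (-s) s (-s) (-s) s
    (by simp) (by simp) (by simp) (by simp) (by simp)
    (by
      intro c hb e e0 e5 e7 r hr
      have h1 := hb (k+2) 1
      have h3 := hb (k+2) 3
      have h6 := hb (k+2) 6
      unfold unst fld
      interval_cases r <;> simp [nbr, e, e0, e5, e7, rowv] <;> rcases hs with rfl | rfl <;> omega)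
    (rowv (-s) (-s) s (-s) (-s) (-s) (-s) s)
    (by funext r; rcases r with _ | _ | _ | _ | _ | _ | _ | _ | r <;> simp [rowv])
  have S9 := mid_step k 7 (by norm_num) up s (-s) hs (by simp) hu hM hU (-s) s (-s) (-s) (-s)
    (by simp) (by simp) (by simp) (by simp) (by simp)
    (by
      intro c hb e e0 e5 e7 r hr
      have h1 := hb (k+2) 1
      have h3 := hb (k+2) 3
      have h6 := hb (k+2) 6
      unfold unst fld
      interval_cases r <;> simp [nbr, e, e0, e5, e7, rowv] <;> rcases hs with rfl | rfl <;> omega)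
    (rowv (-s) (-s) s (-s) (-s) (-s) (-s) (-s))
    (by funext r; rcases r with _ | _ | _ | _ | _ | _ | _ | _ | r <;> simp [rowv])
  have hfin : rest (-s) (k+1) = rowv (-s) (-s) s (-s) (-s) (-s) (-s) (-s) := by simp [rest]
  rw [hfin]
  refine ⟨_, S1.append (R1.append (S2.append (S3.append (S4.append (R2.append (S5.append
    (S6.append (S7.append (R3.append (S8.append S9)))))))))), ?_⟩
  simp only [List.length_append, pow_succ]
  omega

theorem claim (k : ℕ) : Claim k := by
  induction k with
  | zero => exact claim_zero
  | succ k ih => exact claim_succ k ih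

/-- top-level run -/
def topup (n : ℕ) : ℕ → ℕ → ℤ := fun b r => if b = n+1 ∧ r = 0 then -1 else 0

theorem main_run (n : ℕ) : ∃ L, Run (comb n (topup n) (restS 1 n) 1) L (comb n (topup n) (rest (-1) n) (-1)) ∧
    3 ^ n ≤ L.length ∧ ∀ b r, r < 8 → ¬ unst (comb n (topup n) (rest (-1) n) (-1)) b r := by
  have hBd : Bd (topup n) := by intro b r; unfold topup; split_ifs <;> simp
  have hU : ∀ s, US n (topup n) s (-1) := by
    intro s x s' h5 h7 b r hb hr
    by_cases h : b = n + 1 ∧ r = 0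
    · obtain ⟨rfl, rfl⟩ := h
      simp [unst, fld, nbr, comb, topup, h5]
    · unfold unst comb
      rw [if_pos hb]
      unfold topup
      rw [if_neg h]; simp
  obtain ⟨L, hL, hl⟩ := claim n (topup n) 1 (by simp) hBd (by simp [topup]) (hU 1)
  refine ⟨L, hL, hl, ?_⟩
  intro b r hr
  rcases Nat.lt_or_ge n b with h | h
  · exact hU (-1) (rest (-1) n) (-1) (by cases n <;> rfl) (by cases n <;> rfl) b r h hr
  · refine low_stable _ (comb_Bd hBd (rest_bd (by simp) n) (by simp)) n (-1) (by simp) ?_ ?_ b r h hr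
    · intro b hb
      unfold comb
      rw [if_neg (by omega)]
      split_ifs with h
      · rw [h]
      · rfl
    · simp [comb, topup]

def coef (b r : ℕ) (p : ℕ × ℕ) : ℤ := 16 ^ b * ((nbr b r).map fun q => if q.1 = p then q.2 else 0).sum

set_option maxHeartbeats 4000000 in
theorem coef_symm (b r b' r' : ℕ) (hr : r < 8) (hr' : r' < 8) : coef b r (b', r') = coef b' r' (b, r) := by
  by_cases h0 : b = b'
  · subst h0
    unfold coef
    congr 1
    rcases b with _ | b <;> interval_cases r <;> interval_cases r' <;> simp [nbr]
  · by_cases h1 : b = b' + 1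
    · subst h1
      unfold coef
      rcases b' with _ | b' <;> interval_cases r <;> interval_cases r' <;> simp [nbr] <;>
        first | omega | (ring_nf; done) | (intros; omega)
    · by_cases h2 : b' = b + 1
      · subst h2
        unfold coef
        rcases b with _ | b <;> interval_cases r <;> interval_cases r' <;> simp [nbr] <;>
          first | omega | (ring_nf; done) | (intros; omega)
      · have key : ∀ a t a' t' : ℕ, t < 8 → a ≠ a' → a ≠ a' + 1 → a' ≠ a + 1 → coef a t (a', t') = 0 := by
          intro a t a' t' ht h h' h''
          unfold coef
          rcases a with _ | a
          · have g1 : ¬ (0 = a') := by omega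
            have g2 : ¬ (1 = a') := by omega
            interval_cases t <;> simp [nbr, g1, g2]
          · have g1 : ¬ (a + 1 = a') := by omega
            have g2 : ¬ (a + 2 = a') := by omega
            have g3 : ¬ (a = a') := by omega
            interval_cases t <;> simp [nbr, g1, g2, g3]
        rw [key b r b' r' hr h0 h1 h2, key b' r' b r hr' (Ne.symm h0) h2 h1]

theorem coef_self (b r : ℕ) (hr : r < 8) : coef b r (b, r) = 0 := by
  unfold coef
  rcases b with _ | b <;> interval_cases r <;> simp [nbr]

theorem nbr_lt (b r : ℕ) (hr : r < 8) : ∀ q ∈ nbr b r, q.1.2 < 8 := by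
  rcases b with _ | b <;> interval_cases r <;> simp [nbr]

theorem nbr_len (b r : ℕ) (hr : r < 8) : (nbr b r).length ≤ 4 := by
  rcases b with _ | b <;> interval_cases r <;> simp [nbr]

def lbl {N : ℕ} (v : Fin N) : ℕ × ℕ := ((v.1 + 5) / 8, (v.1 + 5) % 8)

theorem lbl_inj {N : ℕ} : Function.Injective (lbl (N := N)) := by
  intro u v h
  unfold lbl at h
  simp only [Prod.mk.injEq] at h
  ext; omega

theorem lbl_lt {N : ℕ} (v : Fin N) : (lbl v).2 < 8 := Nat.mod_lt _ (by norm_num)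

def Jm {N : ℕ} (u v : Fin N) : ℤ := coef (lbl u).1 (lbl u).2 (lbl v)

theorem Jm_symm {N : ℕ} (u v : Fin N) : Jm u v = Jm v u := coef_symm _ _ _ _ (lbl_lt u) (lbl_lt v)

def GG (N : ℕ) : SimpleGraph (Fin N) where
  Adj u v := Jm u v ≠ 0
  symm := ⟨fun u v h => by rw [Jm_symm]; exact h⟩
  loopless := ⟨fun u h => h (coef_self _ _ (lbl_lt u))⟩

noncomputable def XX (N : ℕ) : Sym2 (Fin N) → ℝ :=
  Sym2.lift ⟨fun u v => -(Jm u v : ℝ), fun u v => by simp only [Jm_symm u v]⟩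

theorem deg_le (N : ℕ) (v : Fin N) : deg (GG N) v ≤ 4 := by
  unfold deg
  have h : ((Finset.univ.filter (fun u => (GG N).Adj v u)).image lbl) ⊆
      ((nbr (lbl v).1 (lbl v).2).map Prod.fst).toFinset := by
    intro p hp
    simp only [Finset.mem_image, Finset.mem_filter, Finset.mem_univ, true_and] at hp
    obtain ⟨u, hu, rfl⟩ := hp
    by_contra hc
    apply hu
    unfold Jm coef
    rw [List.sum_eq_zero, mul_zero]
    intro x hx
    simp only [List.mem_map] at hx
    obtain ⟨q, hq, rfl⟩ := hx
    rw [if_neg]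
    intro rfl_
    apply hc
    simp only [List.mem_toFinset, List.mem_map]
    exact ⟨q, hq, rfl_⟩
  rw [← Finset.card_image_of_injective _ lbl_inj]
  calc _ ≤ _ := Finset.card_le_card h
    _ ≤ _ := List.toFinset_card_le _
    _ ≤ 4 := by rw [List.length_map]; exact nbr_len _ _ (lbl_lt v)

theorem impr_single {V : Type*} [Fintype V] (G : SimpleGraph V) (X : Sym2 V → ℝ) (σ : V → ℝ) (v : V) :
    impr G X σ {v} = ∑ u ∈ Finset.univ.filter (fun u => G.Adj v u), σ v * σ u * X s(v, u) := by
  unfold impr cutValue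
  rw [← mul_sub, ← Finset.sum_sub_distrib]
  have himg : (Finset.univ.filter (fun u => G.Adj v u)).image (fun u => s(v, u)) =
      (Finset.univ.filter (fun e => e ∈ G.edgeSet)).filter (fun e => v ∈ e) := by
    ext e
    induction e using Sym2.ind with
    | _ a b =>
      simp only [Finset.mem_image, Finset.mem_filter, Finset.mem_univ, true_and,
        SimpleGraph.mem_edgeSet, Sym2.mem_iff]
      constructor
      · rintro ⟨u, hu, h⟩
        rcases Sym2.eq_iff.1 h with ⟨rfl, rfl⟩ | ⟨rfl, rfl⟩
        · exact ⟨hu, Or.inl rfl⟩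
        · exact ⟨hu.symm, Or.inr rfl⟩
      · rintro ⟨h, rfl | rfl⟩
        · exact ⟨b, h, rfl⟩
        · exact ⟨a, h.symm, Sym2.eq_swap⟩
  have h2 : ∑ u ∈ Finset.univ.filter (fun u => G.Adj v u), σ v * σ u * X s(v, u) =
      ∑ e ∈ (Finset.univ.filter (fun e => e ∈ G.edgeSet)).filter (fun e => v ∈ e),
        Sym2.lift ⟨fun u w => σ u * σ w, fun u w => by ring⟩ e * X e := by
    rw [← himg, Finset.sum_image]
    · rfl
    · intro a _ b _ h
      rcases Sym2.eq_iff.1 h with ⟨_, h⟩ | ⟨h, h'⟩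
      · exact h
      · rw [h', h]
  rw [h2, Finset.sum_filter (fun e => v ∈ e), Finset.mul_sum]
  apply Finset.sum_congr rfl
  intro e he
  simp only [Finset.mem_filter, Finset.mem_univ, true_and] at he
  induction e using Sym2.ind with
  | _ a b =>
    have hab : a ≠ b := G.ne_of_adj he
    simp only [Sym2.lift_mk, flip, Finset.mem_singleton, Sym2.mem_iff]
    by_cases h : v = a
    · subst h
      simp [hab.symm]; ring
    · by_cases h' : v = b
      · subst h'
        simp [hab]; ring
      · simp [h, h', Ne.symm h, Ne.symm h']

noncomputable def sg (N : ℕ) (c : ℕ → ℕ → ℤ) : Fin N → ℝ := fun v => (c (lbl v).1 (lbl v).2 : ℝ)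

def InR (N : ℕ) (c : ℕ → ℕ → ℤ) : Prop := ∀ b r, r < 8 → c b r ≠ 0 → ∃ v : Fin N, lbl v = (b, r)

theorem sum_list {N : ℕ} (c : ℕ → ℕ → ℤ) (hc : InR N c) (l : List ((ℕ × ℕ) × ℤ))
    (hl : ∀ q ∈ l, q.1.2 < 8) :
    ∑ u : Fin N, (l.map fun q => if q.1 = lbl u then q.2 else 0).sum * c (lbl u).1 (lbl u).2 =
      (l.map fun p => p.2 * c p.1.1 p.1.2).sum := by
  induction l with
  | nil => simp
  | cons q l ih =>
    simp only [List.map_cons, List.sum_cons, add_mul, Finset.sum_add_distrib]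
    rw [ih (fun q hq => hl q (List.mem_cons_of_mem _ hq))]
    congr 1
    by_cases h : c q.1.1 q.1.2 = 0
    · rw [h, mul_zero]
      apply Finset.sum_eq_zero
      intro u _
      split_ifs with h'
      · rw [← h', h, mul_zero]
      · simp
    · obtain ⟨v, hv⟩ := hc _ _ (hl q List.mem_cons_self) h
      rw [Finset.sum_eq_single v]
      · rw [hv]; simp
      · intro u _ hu
        rw [if_neg, zero_mul]
        intro h'
        exact hu (lbl_inj (by rw [hv, ← h']))
      · simp

theorem impr_iff (N : ℕ) (c : ℕ → ℕ → ℤ) (hc : InR N c) (v : Fin N) :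
    0 < impr (GG N) (XX N) (sg N c) {v} ↔ unst c (lbl v).1 (lbl v).2 := by
  rw [impr_single]
  have h1 : ∑ u ∈ Finset.univ.filter (fun u => (GG N).Adj v u), sg N c v * sg N c u * XX N s(v, u) =
      ((-(16 ^ (lbl v).1 * (c (lbl v).1 (lbl v).2 * fld c (lbl v).1 (lbl v).2)) : ℤ) : ℝ) := by
    have h2 : ∑ u : Fin N, Jm v u * c (lbl u).1 (lbl u).2 = 16 ^ (lbl v).1 * fld c (lbl v).1 (lbl v).2 := by
      unfold fld
      rw [← sum_list c hc _ (nbr_lt _ _ (lbl_lt v)), Finset.mul_sum]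
      apply Finset.sum_congr rfl
      intro u _
      unfold Jm coef
      rw [mul_assoc]
    have h3 : (-(16 ^ (lbl v).1 * (c (lbl v).1 (lbl v).2 * fld c (lbl v).1 (lbl v).2)) : ℤ) =
        ∑ u : Fin N, -(c (lbl v).1 (lbl v).2 * (Jm v u * c (lbl u).1 (lbl u).2)) := by
      rw [Finset.sum_neg_distrib, ← Finset.mul_sum, h2]; ring
    rw [h3, Finset.sum_filter]
    push_cast
    apply Finset.sum_congr rfl
    intro u _
    split_ifs with h
    · simp only [sg, XX, Sym2.lift_mk]; ring
    · have : Jm v u = 0 := by by_contra h'; exact h h'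
      rw [this]; simp
  rw [h1]
  unfold unst
  have : (0 : ℤ) < 16 ^ (lbl v).1 := by positivity
  rw [Int.cast_pos, neg_pos]
  constructor
  · intro h; by_contra h'; exact absurd h (not_lt.2 (mul_nonneg this.le (not_lt.1 h')))
  · intro h; exact mul_neg_of_pos_of_neg this h

theorem InR_flip {N : ℕ} {c : ℕ → ℕ → ℤ} (hc : InR N c) (v : ℕ × ℕ) : InR N (flipc c v) := by
  intro b r hr h
  apply hc b r hr
  intro h'
  apply h
  unfold flipc
  split_ifs <;> simp [h']

theorem sg_flip {N : ℕ} (c : ℕ → ℕ → ℤ) (v : Fin N) : flip (sg N c) {v} = sg N (flipc c (lbl v)) := by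
  funext u
  unfold flip sg flipc
  by_cases h : u = v
  · subst h; simp
  · have : ¬ ((lbl u).1 = (lbl v).1 ∧ (lbl u).2 = (lbl v).2) := by
      intro h'; exact h (lbl_inj (Prod.ext h'.1 h'.2))
    simp [h, this]

theorem run_lift (N : ℕ) (L : List (ℕ × ℕ)) : ∀ c c', InR N c → Run c L c' →
    ∃ M : List (Finset (Fin N)), M.length = L.length ∧ (∀ S ∈ M, S.card = 1) ∧
      Improving (GG N) (XX N) (sg N c) M ∧ applyList (sg N c) M = sg N c' ∧ InR N c' ∧
      (∀ (i : ℕ) (hi : i < M.length) (w : Fin N),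
          0 < impr (GG N) (XX N) (applyList (sg N c) (M.take i)) {w} ↔ w ∈ M.get ⟨i, hi⟩) := by
  induction L with
  | nil =>
    intro c c' hc h
    cases h
    exact ⟨[], rfl, by simp, trivial, rfl, hc, fun i hi => absurd hi (by simp)⟩
  | cons p L ih =>
    intro c c' hc h
    obtain ⟨⟨hp, h1⟩, h2⟩ := h
    have hu : unst c p.1 p.2 := (h1 _ _ hp).2 ⟨rfl, rfl⟩
    obtain ⟨v, hv⟩ := hc p.1 p.2 hp (by intro h; unfold unst at hu; rw [h] at hu; simp at hu)
    have hv' : lbl v = p := hv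
    subst hv'
    obtain ⟨M, m1, m2, m3, m4, m5, m6⟩ := ih _ _ (InR_flip hc _) h2
    rw [← sg_flip] at m3 m4 m6
    refine ⟨{v} :: M, by simp [m1], ?_, ⟨(impr_iff N c hc v).2 hu, m3⟩, m4, m5, ?_⟩
    · intro S hS
      rcases List.mem_cons.1 hS with rfl | h
      · simp
      · exact m2 S h
    · intro i hi w
      cases i with
      | zero =>
        simp only [List.take_zero, applyList, List.get_eq_getElem, List.getElem_cons_zero, Finset.mem_singleton]
        rw [impr_iff N c hc, h1 _ _ (lbl_lt w)]
        constructor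
        · intro h; exact lbl_inj (Prod.ext h.1 h.2)
        · rintro rfl; exact ⟨rfl, rfl⟩
      | succ i =>
        have := m6 i (by simpa using hi) w
        simpa [applyList] using this

theorem uniq {V : Type*} [Fintype V] (G : SimpleGraph V) (X : Sym2 V → ℝ) (M : List (Finset V)) :
    ∀ σ, (∀ S ∈ M, S.card = 1) → Improving G X σ M → IsLocalOpt G X (applyList σ M) →
      (∀ (i : ℕ) (hi : i < M.length) (w : V),
          0 < impr G X (applyList σ (M.take i)) {w} ↔ w ∈ M.get ⟨i, hi⟩) →
      ∀ L' : List (Finset V), ((∀ S ∈ L', S.card = 1) ∧ Improving G X σ L' ∧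
            IsLocalOpt G X (applyList σ L')) → L' = M := by
  induction M with
  | nil =>
    intro σ _ _ h3 _ L' hL
    cases L' with
    | nil => rfl
    | cons S L' =>
      obtain ⟨v, rfl⟩ := Finset.card_eq_one.1 (hL.1 S List.mem_cons_self)
      exact absurd hL.2.1.1 (not_lt.2 (h3 v))
  | cons T M ih =>
    intro σ h1 h2 h3 h4 L' hL
    obtain ⟨t, rfl⟩ := Finset.card_eq_one.1 (h1 T List.mem_cons_self)
    cases L' with
    | nil => exact absurd h2.1 (not_lt.2 (hL.2.2 t))
    | cons S L' =>
      obtain ⟨v, rfl⟩ := Finset.card_eq_one.1 (hL.1 S List.mem_cons_self)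
      have := (h4 0 (by simp) v).1 (by simpa [applyList] using hL.2.1.1)
      simp at this
      subst this
      congr 1
      apply ih (flip σ {v}) (fun S hS => h1 S (List.mem_cons_of_mem _ hS)) h2.2 h3
      · intro i hi w
        have := h4 (i+1) (by simpa using hi) w
        simpa [applyList] using this
      · exact ⟨fun S hS => hL.1 S (List.mem_cons_of_mem _ hS), hL.2.1.2, hL.2.2⟩

theorem init_pm (n b r : ℕ) (hr : r < 8) :
    ((5 ≤ 8 * b + r ∧ 8 * b + r ≤ 8 * n + 8) → comb n (topup n) (restS 1 n) 1 b r = 1 ∨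
      comb n (topup n) (restS 1 n) 1 b r = -1) ∧
    (¬ (5 ≤ 8 * b + r ∧ 8 * b + r ≤ 8 * n + 8) → comb n (topup n) (restS 1 n) 1 b r = 0) := by
  unfold comb topup
  rcases lt_trichotomy b n with h | h | h
  · rw [if_neg (by omega), if_neg (by omega)]
    rcases b with _ | b <;> interval_cases r <;> simp [rest, rowv] <;> omega
  · rw [if_neg (by omega), if_pos h]
    subst h
    rcases b with _ | b <;> interval_cases r <;> simp [restS, rowv] <;> omega
  · rw [if_pos h]
    by_cases h' : b = n + 1 ∧ r = 0
    · simp [h']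
      omega
    · simp only [if_neg h']
      refine ⟨fun h => ?_, fun _ => trivial⟩
      omega

/-- For every `n` there is a weighted graph with exactly `8n + 4` vertices
and maximum degree at most 4, and a cut `σ₀`, such that (i) there is a unique improving 1-flip
sequence `L` from `σ₀` ending in a local optimum, (ii) `L` has length at least `3 ^ n`, and
(iii) at every intermediate cut reached by `L`, the vertex moved next by `L` is the unique
vertex whose single-vertex move is improving at that cut. -/
theorem flip_unique_pivot_exponential_runtime (n : ℕ) :
    ∃ (G : SimpleGraph (Fin (8 * n + 4))) (X : Sym2 (Fin (8 * n + 4)) → ℝ)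
      (σ₀ : Fin (8 * n + 4) → ℝ),
      (∀ v, deg G v ≤ 4) ∧
      IsCut σ₀ ∧
      ∃ L : List (Finset (Fin (8 * n + 4))),
        ((∀ S ∈ L, S.card = 1) ∧ Improving G X σ₀ L ∧ IsLocalOpt G X (applyList σ₀ L)) ∧
        (∀ L' : List (Finset (Fin (8 * n + 4))),
          ((∀ S ∈ L', S.card = 1) ∧ Improving G X σ₀ L' ∧
            IsLocalOpt G X (applyList σ₀ L')) → L' = L) ∧
        3 ^ n ≤ L.length ∧
        (∀ (i : ℕ) (hi : i < L.length) (w : Fin (8 * n + 4)),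
          0 < impr G X (applyList σ₀ (L.take i)) {w} ↔ w ∈ L.get ⟨i, hi⟩) := by
  obtain ⟨L, hL, hlen, hst⟩ := main_run n
  have hin : InR (8 * n + 4) (comb n (topup n) (restS 1 n) 1) := by
    intro b r hr h
    have h' : 5 ≤ 8 * b + r ∧ 8 * b + r ≤ 8 * n + 8 := by
      by_contra hc; exact h ((init_pm n b r hr).2 hc)
    refine ⟨⟨8 * b + r - 5, by omega⟩, ?_⟩
    unfold lbl
    apply Prod.ext
    · change (8 * b + r - 5 + 5) / 8 = b; omega
    · change (8 * b + r - 5 + 5) % 8 = r; omega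
  obtain ⟨M, m1, m2, m3, m4, m5, m6⟩ := run_lift (8 * n + 4) L _ _ hin hL
  have hopt : IsLocalOpt (GG (8 * n + 4)) (XX (8 * n + 4))
      (applyList (sg (8 * n + 4) (comb n (topup n) (restS 1 n) 1)) M) := by
    intro v
    rw [m4]
    exact not_lt.1 fun h => hst _ _ (lbl_lt v) ((impr_iff _ _ m5 v).1 h)
  refine ⟨GG (8 * n + 4), XX (8 * n + 4), sg (8 * n + 4) (comb n (topup n) (restS 1 n) 1),
    deg_le _, ?_, M, ⟨m2, m3, hopt⟩, uniq _ _ M _ m2 m3 hopt m6, by rw [m1]; exact hlen, m6⟩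
  intro v
  have hv := v.2
  unfold sg
  rcases (init_pm n (lbl v).1 (lbl v).2 (lbl_lt v)).1 (by unfold lbl; simp only; omega) with h | h
  · left; rw [h]; norm_num
  · right; rw [h]; norm_num

end MaxCut
end

section
/- Let G = (V, E, X) be a finite weighted graph, let k ≥ 1, and let v₁, w₁, …, v_k, w_k be 2k distinct vertices such that U := {v₁, w₁, …, v_k, w_k} is an independent set. Let σ be a cut of G satisfying |impr_σ(u) − 3^{−(i−1)}| < 3^{−k} for all i ∈ [k] and u ∈ {v_i, w_i}. Then there exists a 3-flip sequence that is improving from σ, moves only vertices from U, and has length at least 2^{k−1}. -/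
open Finset
open scoped Classical

namespace MaxCut

variable {V : Type*} [Fintype V]

lemma flip_flip (σ : V → ℝ) (S T : Finset V) : flip (flip σ S) T = flip σ (symmDiff S T) := by
  funext x
  simp only [flip, Finset.mem_symmDiff]
  by_cases h1 : x ∈ S <;> by_cases h2 : x ∈ T <;> simp [h1, h2]

lemma impr_insert (G : SimpleGraph V) (X : Sym2 V → ℝ) (σ : V → ℝ) (S : Finset V) (u : V)
    (hu : u ∉ S) (hS : ∀ x ∈ S, ¬ G.Adj u x) :
    impr G X σ (insert u S) = impr G X σ {u} + impr G X σ S := by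
  simp only [impr, cutValue]
  rw [← mul_sub, ← mul_sub, ← mul_sub, ← mul_add, ← Finset.sum_sub_distrib,
    ← Finset.sum_sub_distrib, ← Finset.sum_sub_distrib, ← Finset.sum_add_distrib]
  congr 1
  apply Finset.sum_congr rfl
  intro e he
  induction e using Sym2.ind with
  | _ a b =>
    have hab : G.Adj a b := by simpa using he
    have hne := hab.ne
    simp only [Sym2.lift_mk, flip, Finset.mem_insert, Finset.mem_singleton]
    by_cases ha : a = u
    · subst ha
      have hb : b ∉ S := fun h => hS b h hab
      simp [hu, hb, hne.symm]
    · by_cases hb : b = u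
      · subst hb
        have hb : a ∉ S := fun h => hS a h hab.symm
        simp [hu, hb, hne]
      · simp [ha, hb]

lemma impr_sum (G : SimpleGraph V) (X : Sym2 V → ℝ) (σ : V → ℝ) (S : Finset V)
    (hS : ∀ x ∈ S, ∀ y ∈ S, ¬ G.Adj x y) :
    impr G X σ S = ∑ u ∈ S, impr G X σ {u} := by
  induction S using Finset.induction_on with
  | empty =>
    have : flip σ ∅ = σ := by funext x; simp [flip]
    simp [impr, this]
  | insert a S ha ih =>
    rw [impr_insert G X σ S a ha (fun x hx => hS a (by simp) x (by simp [hx])),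
      Finset.sum_insert ha, ih (fun x hx y hy => hS x (by simp [hx]) y (by simp [hy]))]

lemma impr_flip (G : SimpleGraph V) (X : Sym2 V → ℝ) (σ : V → ℝ) (S T : Finset V) :
    impr G X (flip σ S) T = impr G X σ (symmDiff S T) - impr G X σ S := by
  simp only [impr, flip_flip]; ring

lemma applyList_append (σ : V → ℝ) (L M : List (Finset V)) :
    applyList σ (L ++ M) = applyList (applyList σ L) M := by
  induction L generalizing σ with
  | nil => rfl
  | cons S L ih => exact ih _

lemma improving_append (G : SimpleGraph V) (X : Sym2 V → ℝ) (σ : V → ℝ) (L M : List (Finset V))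
    (h1 : Improving G X σ L) (h2 : Improving G X (applyList σ L) M) :
    Improving G X σ (L ++ M) := by
  induction L generalizing σ with
  | nil => exact h2
  | cons S L ih => exact ⟨h1.1, ih _ h1.2 h2⟩

lemma counter_aux (G : SimpleGraph V) (X : Sym2 V → ℝ)
    (k : ℕ) (v w : ℕ → V) (U : Set V)
    (hv : ∀ i < k, v i ∈ U) (hw : ∀ i < k, w i ∈ U)
    (hvv : ∀ i < k, ∀ j < k, v i = v j → i = j)
    (hww : ∀ i < k, ∀ j < k, w i = w j → i = j)
    (hvw : ∀ i < k, ∀ j < k, v i ≠ w j)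
    (hU : ∀ u ∈ U, ∀ x ∈ U, ¬ G.Adj u x) (p : ℕ → ℝ) (ε : ℝ)
    (hp : ∀ i, i + 1 < k → p i = 3 * p (i + 1)) (hε : ∀ i < k, 3 * ε ≤ p i) (hε0 : 0 < ε)
    (d : ℕ) : ∀ (j : ℕ) (_ : j + d + 1 = k) (σ : V → ℝ)
    (_ : ∀ i, j ≤ i → i < k → |impr G X σ {v i} - p i| < ε ∧ |impr G X σ {w i} - p i| < ε),
    ∃ L : List (Finset V),
      (∀ S ∈ L, S.card ≤ 3) ∧ Improving G X σ L ∧ (∀ S ∈ L, ∀ x ∈ S, x ∈ U) ∧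
      2 ^ d ≤ L.length ∧ applyList σ L = flip σ {v j, w j} := by
  induction d with
  | zero =>
    intro j hj σ h
    have hjk : j < k := by omega
    have hne := hvw j hjk j hjk
    obtain ⟨h1, h2⟩ := h j le_rfl hjk
    have h3 := hε j hjk
    rw [abs_lt] at h1 h2
    have e1 : symmDiff ({v j} : Finset V) {w j} = {v j, w j} := by
      ext x; simp only [Finset.mem_symmDiff, Finset.mem_insert, Finset.mem_singleton]; grind
    have hs : impr G X σ {v j, w j} = impr G X σ {v j} + impr G X σ {w j} := by
      rw [impr_insert _ _ _ _ _ (by simpa using hne)]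
      intro x hx
      rw [Finset.mem_singleton] at hx; subst hx
      exact hU _ (hv j hjk) _ (hw j hjk)
    refine ⟨[{v j}, {w j}], by simp, ⟨by linarith, ?_, trivial⟩, ?_, by simp, ?_⟩
    · rw [impr_flip, e1, hs]; linarith
    · simp [hv j hjk, hw j hjk]
    · simp only [applyList, flip_flip, e1]
  | succ d ih =>
    intro j hj σ h
    have hjk : j < k := by omega
    have hjk' : j + 1 < k := by omega
    have hne := hvw j hjk j hjk
    have hne' := hvw (j+1) hjk' (j+1) hjk'
    have n1 := hvw j hjk (j+1) hjk'
    have n2 := hvw (j+1) hjk' j hjk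
    have n3 : v j ≠ v (j+1) := fun e => by have := hvv _ hjk _ hjk' e; omega
    have n4 : w j ≠ w (j+1) := fun e => by have := hww _ hjk _ hjk' e; omega
    obtain ⟨h1, h2⟩ := h j le_rfl hjk
    obtain ⟨h1', h2'⟩ := h (j+1) (by omega) hjk'
    have h3 := hε (j+1) hjk'
    have h4 := hp j hjk'
    rw [abs_lt] at h1 h2 h1' h2'
    have hvj := hv j hjk
    have hwj := hw j hjk
    have hvj' := hv _ hjk'
    have hwj' := hw _ hjk'
    have hsum : ∀ S : Finset V, (∀ x ∈ S, x ∈ U) → impr G X σ S = ∑ u ∈ S, impr G X σ {u} :=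
      fun S hS => impr_sum G X σ S (fun x hx y hy => hU x (hS x hx) y (hS y hy))
    have hflip : ∀ u ∈ U, u ≠ v j → impr G X (flip σ {v j}) {u} = impr G X σ {u} := by
      intro u hu hne
      have : symmDiff ({v j} : Finset V) {u} = {v j, u} := by
        ext x; simp only [Finset.mem_symmDiff, Finset.mem_insert, Finset.mem_singleton]; grind
      rw [impr_flip, this, hsum {v j, u} (by simp [hu, hvj]),
        Finset.sum_pair hne.symm]
      ring
    obtain ⟨L, a1, a2, a3, a4, a5⟩ := ih (j+1) (by omega) σ
      (fun i hi hik => h i (by omega) hik)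
    obtain ⟨M, b1, b2, b3, b4, b5⟩ := ih (j+1) (by omega) (flip σ {v j}) (by
      intro i hi hik
      rw [hflip _ (hv i hik) (fun e => by have := hvv _ hik _ hjk e; omega),
        hflip _ (hw i hik) (hvw _ hjk _ hik).symm]
      exact h i (by omega) hik)
    have e1 : symmDiff ({v (j+1), w (j+1)} : Finset V) {v j, v (j+1), w (j+1)} = {v j} := by
      ext x; simp only [Finset.mem_symmDiff, Finset.mem_insert, Finset.mem_singleton]; grind
    have e2 : symmDiff ({v j} : Finset V) {v (j+1), w (j+1)} = {v j, v (j+1), w (j+1)} := by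
      ext x; simp only [Finset.mem_symmDiff, Finset.mem_insert, Finset.mem_singleton]; grind
    have e3 : symmDiff ({v j, v (j+1), w (j+1)} : Finset V) {w j, v (j+1), w (j+1)}
        = {v j, w j} := by
      ext x; simp only [Finset.mem_symmDiff, Finset.mem_insert, Finset.mem_singleton]; grind
    have s1 : impr G X σ {v (j+1), w (j+1)}
        = impr G X σ {v (j+1)} + impr G X σ {w (j+1)} := by
      rw [hsum _ (by simp [hvj', hwj']), Finset.sum_pair hne']
    have s2 : impr G X σ {v j, v (j+1), w (j+1)}
        = impr G X σ {v j} + (impr G X σ {v (j+1)} + impr G X σ {w (j+1)}) := by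
      rw [hsum _ (by simp [hvj, hvj', hwj']), Finset.sum_insert (by simp [n1, n3]),
        Finset.sum_pair hne']
    have s3 : impr G X σ {v j, w j} = impr G X σ {v j} + impr G X σ {w j} := by
      rw [hsum _ (by simp [hvj, hwj]), Finset.sum_pair hne]
    have c1 : applyList σ (L ++ [{v j, v (j+1), w (j+1)}]) = flip σ {v j} := by
      rw [applyList_append, a5]; simp only [applyList, flip_flip, e1]
    have c2 : applyList σ ((L ++ [{v j, v (j+1), w (j+1)}]) ++ M)
        = flip σ {v j, v (j+1), w (j+1)} := by
      rw [applyList_append, c1, b5, flip_flip, e2]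
    refine ⟨((L ++ [{v j, v (j+1), w (j+1)}]) ++ M) ++ [{w j, v (j+1), w (j+1)}],
      ?_, ?_, ?_, ?_, ?_⟩
    · intro S hS
      simp only [List.mem_append, List.mem_singleton] at hS
      rcases hS with ((hS | rfl) | hS) | rfl
      · exact a1 S hS
      · exact Finset.card_le_three
      · exact b1 S hS
      · exact Finset.card_le_three
    · apply improving_append
      · apply improving_append
        · apply improving_append _ _ _ _ _ a2
          rw [a5]
          refine ⟨?_, trivial⟩
          rw [impr_flip, e1, s1]; linarith
        · rw [c1]; exact b2
      · rw [c2]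
        refine ⟨?_, trivial⟩
        rw [impr_flip, e3, s2, s3]; linarith
    · intro S hS
      simp only [List.mem_append, List.mem_singleton] at hS
      rcases hS with ((hS | rfl) | hS) | rfl
      · exact a3 S hS
      · simp [hvj, hvj', hwj']
      · exact b3 S hS
      · simp [hwj, hvj', hwj']
    · simp only [List.length_append, List.length_singleton, pow_succ]; omega
    · rw [applyList_append, c2]; simp only [applyList, flip_flip, e3]

/-- If `v₁, w₁, …, v_k, w_k` are `2k` distinct vertices forming an independent set
`U` and `σ` is a cut with `|impr_σ(u) − 3^{−(i−1)}| < 3^{−k}` for all `i ∈ [k]`,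
`u ∈ {v_i, w_i}` (here `i : Fin k` is zero-based, so `3^{−(i−1)}` becomes `3^{−(i : ℕ)}`),
then there is a 3-flip sequence improving from `σ`, moving only vertices of `U`, of length at
least `2^{k−1}`. -/
theorem binary_counter_three_flip {V : Type*} [Fintype V]
    (G : SimpleGraph V) (X : Sym2 V → ℝ)
    (k : ℕ) (hk : 1 ≤ k) (v w : Fin k → V)
    (hdistinct : Function.Injective (Sum.elim v w))
    (hU : ∀ u ∈ Set.range v ∪ Set.range w, ∀ x ∈ Set.range v ∪ Set.range w, ¬ G.Adj u x)
    (σ : V → ℝ) (hσ : IsCut σ)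
    (himpr : ∀ i : Fin k, ∀ u ∈ ({v i, w i} : Set V),
      |impr G X σ {u} - (3 : ℝ) ^ (-(i : ℤ))| < (3 : ℝ) ^ (-(k : ℤ))) :
    ∃ L : List (Finset V),
      (∀ S ∈ L, S.card ≤ 3) ∧
      Improving G X σ L ∧
      (∀ S ∈ L, ∀ x ∈ S, x ∈ Set.range v ∪ Set.range w) ∧
      2 ^ (k - 1) ≤ L.length := by
  have h0 : 0 < k := hk
  let v' : ℕ → V := fun i => if h : i < k then v ⟨i, h⟩ else v ⟨0, h0⟩
  let w' : ℕ → V := fun i => if h : i < k then w ⟨i, h⟩ else w ⟨0, h0⟩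
  have ev : ∀ i (h : i < k), v' i = v ⟨i, h⟩ := fun i h => by simp [v', h]
  have ew : ∀ i (h : i < k), w' i = w ⟨i, h⟩ := fun i h => by simp [w', h]
  obtain ⟨L, a1, a2, a3, a4, -⟩ := counter_aux G X k v' w' (Set.range v ∪ Set.range w)
    (fun i h => by rw [ev i h]; exact Or.inl ⟨_, rfl⟩)
    (fun i h => by rw [ew i h]; exact Or.inr ⟨_, rfl⟩)
    (fun i hi j hj e => by
      rw [ev i hi, ev j hj] at e
      have := @hdistinct (Sum.inl ⟨i, hi⟩) (Sum.inl ⟨j, hj⟩) e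
      simpa using this)
    (fun i hi j hj e => by
      rw [ew i hi, ew j hj] at e
      have := @hdistinct (Sum.inr ⟨i, hi⟩) (Sum.inr ⟨j, hj⟩) e
      simpa using this)
    (fun i hi j hj e => by
      rw [ev i hi, ew j hj] at e
      have := @hdistinct (Sum.inl ⟨i, hi⟩) (Sum.inr ⟨j, hj⟩) e
      simp at this)
    hU (fun i => (3 : ℝ) ^ (-(i : ℤ))) ((3 : ℝ) ^ (-(k : ℤ)))
    (fun i _ => by
      have : (-(i : ℤ)) = 1 + (-((i + 1 : ℕ) : ℤ)) := by push_cast; ring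
      rw [this, zpow_add₀ (by norm_num), zpow_one])
    (fun i hi => by
      have : (3 : ℝ) * 3 ^ (-(k : ℤ)) = 3 ^ (1 + (-(k : ℤ))) := by
        rw [zpow_add₀ (by norm_num), zpow_one]
      rw [this]
      exact zpow_le_zpow_right₀ (by norm_num) (by omega))
    (by positivity) (k - 1) 0 (by omega) σ
    (fun i _ hi => by
      rw [ev i hi, ew i hi]
      exact ⟨himpr ⟨i, hi⟩ _ (by simp), himpr ⟨i, hi⟩ _ (by simp)⟩)
  exact ⟨L, a1, a2, a3, a4⟩

end MaxCut
end
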